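/- Let ε ≠ 0 be real and let Ω be the 4×4 matrix defined in the context (which is invertible). Let A be a 2×4 complex matrix of rank 2 and set M = ker A ⊆ ℂ⁴. Then the image Ω·M equals the orthogonal complement M^⊥ if and only if A·Ω⁻¹·A* = 0, where A* denotes the conjugate transpose of A. -/

import Mathlib

open Matrix

/-- For `M = ker A` with `A` of rank 2, the self-adjointness condition `Ω M = M^⊥`
is equivalent to the matrix equation `A Ω⁻¹ A* = 0`. -/
theorem stmt4 (ε : ℝ) (hε : ε ≠ 0)
    (Ω : Matrix (Fin 4) (Fin 4) ℂ)
    (hΩ : Ω = !![0, 1, (ε : ℂ), 0; -1, 0, 0, -(ε : ℂ); -(ε : ℂ), 0, 0, 0; 0, (ε : ℂ), 0, 0])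
    (A : Matrix (Fin 2) (Fin 4) ℂ) (hA : A.rank = 2)
    (M : Submodule ℂ (EuclideanSpace ℂ (Fin 4)))
    (hM : M = LinearMap.ker (Matrix.toEuclideanLin A)) :
    M.map (Matrix.toEuclideanLin Ω) = Mᗮ ↔ A * Ω⁻¹ * Aᴴ = 0 := by
  have hdet : IsUnit Ω.det := by
    have : Ω.det = (ε : ℂ) ^ 4 := by
      rw [hΩ]
      simp [Matrix.det_succ_row_zero, Fin.sum_univ_succ, Fin.succAbove]
      try ring
    rw [this, isUnit_iff_ne_zero]
    exact pow_ne_zero _ (by exact_mod_cast hε)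
  have hmul : ∀ {l m n : ℕ} (B : Matrix (Fin l) (Fin m) ℂ) (C : Matrix (Fin m) (Fin n) ℂ) x,
      Matrix.toEuclideanLin (B * C) x = Matrix.toEuclideanLin B (Matrix.toEuclideanLin C x) := by
    intro l m n B C x
    simp [Matrix.toLpLin_apply, Matrix.mulVec_mulVec]
  have hone : ∀ x, Matrix.toEuclideanLin (1 : Matrix (Fin 4) (Fin 4) ℂ) x = x := by
    intro x
    simp [Matrix.toLpLin_apply]
  have hleft : ∀ x, Matrix.toEuclideanLin Ω⁻¹ (Matrix.toEuclideanLin Ω x) = x := by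
    intro x
    rw [← hmul, Matrix.nonsing_inv_mul _ hdet, hone]
  have hright : ∀ x, Matrix.toEuclideanLin Ω (Matrix.toEuclideanLin Ω⁻¹ x) = x := by
    intro x
    rw [← hmul, Matrix.mul_nonsing_inv _ hdet, hone]
  have hperp : Mᗮ = LinearMap.range (Matrix.toEuclideanLin Aᴴ) := by
    rw [hM, Matrix.toEuclideanLin_conjTranspose_eq_adjoint, LinearMap.orthogonal_ker]
  have hrk : Module.finrank ℂ (LinearMap.range (Matrix.toEuclideanLin A)) = 2 := by
    rw [Matrix.rank_eq_finrank_range_toLin A (EuclideanSpace.basisFun _ ℂ).toBasis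
      (EuclideanSpace.basisFun _ ℂ).toBasis, ← Matrix.toEuclideanLin_eq_toLin_orthonormal] at hA
    exact hA
  have hMdim : Module.finrank ℂ M = 2 := by
    have := LinearMap.finrank_range_add_finrank_ker (Matrix.toEuclideanLin A)
    rw [hrk, ← hM, finrank_euclideanSpace_fin] at this
    omega
  have hperpdim : Module.finrank ℂ Mᗮ = 2 := by
    have := M.finrank_add_finrank_orthogonal
    rw [hMdim, finrank_euclideanSpace_fin] at this
    omega
  have hmapdim : Module.finrank ℂ (M.map (Matrix.toEuclideanLin Ω)) = 2 := by
    rw [← hMdim]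
    exact (Submodule.equivMapOfInjective _ (Function.LeftInverse.injective hleft) M).finrank_eq.symm
  have key : Mᗮ ≤ M.map (Matrix.toEuclideanLin Ω) ↔ A * Ω⁻¹ * Aᴴ = 0 := by
    rw [hperp]
    constructor
    · intro h
      apply Matrix.toEuclideanLin.injective
      ext1 x
      obtain ⟨y, hy, hy'⟩ := h ⟨x, rfl⟩
      rw [hmul, hmul, ← hy', hleft, map_zero]
      rw [hM] at hy
      exact hy
    · rintro h _ ⟨x, rfl⟩
      refine ⟨Matrix.toEuclideanLin Ω⁻¹ (Matrix.toEuclideanLin Aᴴ x), ?_, hright _⟩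
      rw [hM]
      change Matrix.toEuclideanLin A _ = 0
      rw [← hmul, ← hmul, h, map_zero]
      rfl
  rw [← key]
  constructor
  · intro h
    exact h.ge
  · intro h
    exact (Submodule.eq_of_le_of_finrank_eq h (by rw [hperpdim, hmapdim])).symm
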